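/- Let p be a prime, G a finite p-group, and set h₁(G) := r_p(H^1(G, 𝔽_p)) where 𝔽_p = ℤ/pℤ carries the trivial G-action. Let M be a G-module that is a p-primary torsion abelian group, and suppose D is a G-submodule of M such that multiplication by p is surjective on D, D[p] is finite of order p^r, and M/D is finite of order p^t. Then for every n ≥ 1, the subgroup H^1(G, M)[pⁿ] is finite of order at most p^{n·h₁(G)·(r+t)}, i.e., ord_p(H^1(G, M)[pⁿ]) ≤ n·h₁(G)·(r + t). -/

import Mathlib

/-!
STATEMENT 11: Let p be a prime, G a finite p-group, and set h₁(G) := r_p(H^1(G, 𝔽_p))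
where 𝔽_p = ℤ/pℤ carries the trivial G-action.  Let M be a G-module that is a p-primary
torsion abelian group, and suppose D is a G-submodule of M such that multiplication by p
is surjective on D, D[p] is finite of order p^r, and M/D is finite of order p^t.
Then for every n ≥ 1, the subgroup H^1(G, M)[pⁿ] is finite of order at most
p^{n·h₁(G)·(r+t)}, i.e. ord_p(H^1(G, M)[pⁿ]) ≤ n·h₁(G)·(r + t).
-/

open groupCohomology

/-- `r_p(N)`: the 𝔽_p-dimension of the p-torsion subgroup `N[p]` of `N`. -/
noncomputable def rp (p : ℕ) (N : Type*) [AddCommGroup N] : ℕ :=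
  letI := AddSubgroup.torsionBy.zmodModule (A := N) (n := p)
  Module.finrank (ZMod p) (AddSubgroup.torsionBy N p)

theorem AddMonoidHom.finite_and_card_le_of_ker_le_range {A B C : Type*} [AddCommGroup A]
    [AddCommGroup B] [AddCommGroup C] [Finite A] [Finite C] (f : A →+ B) (g : B →+ C)
    (h : g.ker ≤ f.range) : Finite B ∧ Nat.card B ≤ Nat.card A * Nat.card C := by
  have hf : Finite f.range := Finite.of_surjective _ f.rangeRestrict_surjective
  have hk : Finite g.ker := Finite.of_injective _ (AddSubgroup.inclusion_injective h)
  have hcard : Nat.card B = Nat.card g.ker * Nat.card g.range := by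
    rw [← AddSubgroup.index_ker, AddSubgroup.card_mul_index]
  refine ⟨?_, ?_⟩
  · refine Nat.finite_of_card_ne_zero ?_
    rw [hcard]
    exact mul_ne_zero Nat.card_pos.ne' Nat.card_pos.ne'
  · rw [hcard]
    refine Nat.mul_le_mul ?_ (Nat.card_le_card_of_injective _ g.range.subtype_injective)
    exact (Nat.card_le_card_of_injective _ (AddSubgroup.inclusion_injective h)).trans
      (Nat.card_le_card_of_surjective _ f.rangeRestrict_surjective)

theorem AddSubgroup.mem_torsionBy_iff {A : Type*} [AddCommGroup A] {m : ℤ} {x : A} :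
    x ∈ torsionBy A m ↔ m • x = 0 :=
  Iff.rfl

theorem AddSubgroup.finite_and_card_torsionBy_pow_le {A : Type*} [AddCommGroup A] (m : ℤ)
    [Finite (torsionBy A m)] (n : ℕ) :
    Finite (torsionBy A (m ^ n)) ∧
      Nat.card (torsionBy A (m ^ n)) ≤ Nat.card (torsionBy A m) ^ n := by
  induction n with
  | zero =>
    have : Subsingleton (torsionBy A (m ^ 0)) :=
      subsingleton_of_forall_eq 0 fun x ↦ Subtype.ext <| by
        simpa [mem_torsionBy_iff] using x.2
    exact ⟨inferInstance, by simp⟩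
  | succ n ih =>
    have := ih.1
    let f : torsionBy A m →+ torsionBy A (m ^ (n + 1)) :=
      AddSubgroup.inclusion fun x hx ↦ by
        rw [mem_torsionBy_iff] at hx ⊢
        rw [pow_succ, mul_smul, hx, smul_zero]
    let g : torsionBy A (m ^ (n + 1)) →+ torsionBy A (m ^ n) :=
      ((zsmulAddGroupHom m).comp (AddSubgroup.subtype _)).codRestrict _ fun x ↦ by
        have hx := x.2
        rw [mem_torsionBy_iff] at hx ⊢
        simpa [pow_succ, mul_smul] using hx
    obtain ⟨h₁, h₂⟩ := AddMonoidHom.finite_and_card_le_of_ker_le_range f g fun x hx ↦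
      ⟨⟨x, mem_torsionBy_iff.2 <| congrArg Subtype.val hx⟩, rfl⟩
    refine ⟨h₁, h₂.trans ?_⟩
    rw [pow_succ']
    exact Nat.mul_le_mul_left _ ih.2

theorem AddSubgroup.card_torsionBy_eq_index (A : Type*) [AddCommGroup A] [Finite A] (m : ℤ) :
    Nat.card (torsionBy A m) = (zsmulAddGroupHom m : A →+ A).range.index := by
  rw [index_range]
  rfl

theorem AddSubgroup.card_torsionBy_le_of_surjective {A B : Type*} [AddCommGroup A]
    [AddCommGroup B] [Finite A] (f : A →+ B) (hf : Function.Surjective f) (m : ℤ) :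
    Nat.card (torsionBy B m) ≤ Nat.card (torsionBy A m) := by
  have := Finite.of_surjective f hf
  have hmap : (zsmulAddGroupHom m : A →+ A).range.map f = (zsmulAddGroupHom m : B →+ B).range := by
    ext b
    simp only [AddSubgroup.mem_map, AddMonoidHom.mem_range, zsmulAddGroupHom_apply,
      exists_exists_eq_and, map_zsmul]
    exact (hf.exists (p := fun y ↦ m • y = b)).symm
  rw [card_torsionBy_eq_index, card_torsionBy_eq_index, ← hmap]
  exact Nat.le_of_dvd (Nat.pos_of_ne_zero AddSubgroup.index_ne_zero_of_finite)
    (AddSubgroup.index_map_dvd _ hf)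

namespace groupCohomology

open CategoryTheory

variable {k G : Type} [CommRing k] [Group G]

theorem H1π_surjective (A : Rep k G) : Function.Surjective (H1π A) :=
  (ModuleCat.epi_iff_surjective _).1 inferInstance

instance finite_H1 [Finite G] (A : Rep k G) [Finite A] : Finite (groupCohomology A 1) :=
  Finite.of_surjective _ (H1π_surjective A)

theorem exists_map_eq_of_map_eq_zero {A B C : Rep k G} (f : A ⟶ B) (g : B ⟶ C)
    (hf : Function.Injective f.hom) (hg : Function.Surjective g.hom)
    (hfg : Function.Exact f.hom g.hom) (x : groupCohomology B 1)
    (hx : map (MonoidHom.id G) g 1 x = 0) :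
    ∃ y, map (MonoidHom.id G) f 1 y = x := by
  have hzero : f ≫ g = 0 := by
    ext a
    exact hfg.apply_apply_eq_zero a
  let S : ShortComplex (Rep k G) := ⟨f, g, hzero⟩
  have hS : S.ShortExact :=
    { exact := by
        rw [← ShortComplex.exact_map_iff_of_faithful S (forget₂ (Rep k G) (ModuleCat k)),
          ShortComplex.ShortExact.moduleCat_exact_iff_function_exact]
        exact hfg
      mono_f := (Rep.mono_iff_injective f).2 hf
      epi_g := (Rep.epi_iff_surjective g).2 hg }
  exact (ShortComplex.moduleCat_exact_iff _).1 (mapShortComplex₂_exact hS 1) x hx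

theorem natCard_smul_H1_eq_zero [Finite G] (A : Rep k G) (x : groupCohomology A 1) :
    Nat.card G • x = 0 := by
  have := Fintype.ofFinite G
  induction x using H1_induction_on with | h x =>
  rw [← map_nsmul, H1π_eq_zero_iff]
  refine ⟨-∑ h : G, x h, funext fun g ↦ ?_⟩
  have h₁ : ∑ h : G, x (g * h) = ∑ h : G, x h :=
    Fintype.sum_equiv (Equiv.mulLeft g) _ _ fun _ ↦ rfl
  have h₂ : ∑ h : G, x (g * h) = A.ρ g (∑ h : G, x h) + Nat.card G • x g := by
    simp [(mem_cocycles₁_iff x).1 x.2 g, Finset.sum_add_distrib, Nat.card_eq_fintype_card]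
  rw [h₁] at h₂
  change A.ρ g (-∑ h : G, x h) - -∑ h : G, x h = Nat.card G • x g
  rw [map_neg]
  nth_rw 2 [h₂]
  abel

theorem card_H1_le_mul {A B C : Rep k G} (f : A ⟶ B)
    (g : B ⟶ C) (hf : Function.Injective f.hom) (hg : Function.Surjective g.hom)
    (hfg : Function.Exact f.hom g.hom) [Finite (groupCohomology A 1)]
    [Finite (groupCohomology C 1)] :
    Nat.card (groupCohomology B 1) ≤
      Nat.card (groupCohomology A 1) * Nat.card (groupCohomology C 1) :=
  (AddMonoidHom.finite_and_card_le_of_ker_le_range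
    (map (MonoidHom.id G) f 1).hom.toAddMonoidHom (map (MonoidHom.id G) g 1).hom.toAddMonoidHom
    fun x hx ↦ exists_map_eq_of_map_eq_zero f g hf hg hfg x hx).2

theorem exists_invariant_addOrderOf_eq {p : ℕ} [Fact p.Prime] (hG : IsPGroup p G)
    (A : Rep k G) [Finite A] (hA : p ∣ Nat.card A) :
    ∃ v : A, (∀ g, A.ρ g v = v) ∧ addOrderOf v = p := by
  let _ : MulAction G A := MulAction.compHom A A.ρ
  have hcard : Nat.card A.ρ.invariants ≡ 0 [MOD p] :=
    (hG.card_modEq_card_fixedPoints A).symm.trans (Nat.modEq_zero_iff_dvd.2 hA)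
  obtain ⟨v, hv⟩ := exists_prime_addOrderOf_dvd_card' (G := A.ρ.invariants) p
    (Nat.modEq_zero_iff_dvd.1 hcard)
  refine ⟨v, v.2, ?_⟩
  rw [← hv]
  exact AddSubgroup.addOrderOf_coe (H := A.ρ.invariants.toAddSubgroup) v

theorem exists_injective_trivial_zmod_hom {p : ℕ} [Fact p.Prime] [Module k (ZMod p)]
    (hk : Function.Surjective (Int.cast : ℤ → k)) (hG : IsPGroup p G)
    (A : Rep k G) [Finite A] (hA : p ∣ Nat.card A) :
    ∃ f : Rep.trivial k G (ZMod p) ⟶ A, Function.Injective f.hom := by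
  obtain ⟨v, hv, hord⟩ := exists_invariant_addOrderOf_eq hG A hA
  let φ : ZMod p →+ A := ZMod.lift p ⟨zmultiplesHom A v, by simp [← hord]⟩
  have hφ : Function.Injective φ := by
    rw [ZMod.lift_injective]
    intro m hm
    rw [ZMod.intCast_zmod_eq_zero_iff_dvd, ← hord]
    exact addOrderOf_dvd_iff_zsmul_eq_zero.2 hm
  have hφv (g : G) (x : ZMod p) : A.ρ g (φ x) = φ x := by
    obtain ⟨m, rfl⟩ := ZMod.intCast_surjective x
    simp [φ, hv]
  refine ⟨Rep.ofHom ⟨{ φ with map_smul' := fun a x ↦ ?_ },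
    fun g ↦ LinearMap.ext fun x ↦ (hφv g x).symm⟩, hφ⟩
  obtain ⟨m, rfl⟩ := hk a
  exact map_intCast_smul φ k k m x

theorem card_H1_le_of_card_eq_pow [Finite G] {p : ℕ} [Fact p.Prime] [Module k (ZMod p)]
    (hk : Function.Surjective (Int.cast : ℤ → k)) (hG : IsPGroup p G) (m : ℕ)
    (A : Rep k G) (hA : Nat.card A = p ^ m) :
    Nat.card (groupCohomology A 1) ≤
      Nat.card (groupCohomology (Rep.trivial k G (ZMod p)) 1) ^ m := by
  have hp : p.Prime := Fact.out
  induction m generalizing A with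
  | zero =>
    have : Subsingleton A := (Nat.card_eq_one_iff_unique.1 (by simpa using hA)).1
    have : Subsingleton (groupCohomology A 1) := (H1π_surjective A).subsingleton
    simp
  | succ m ih =>
    have : Finite A := Nat.finite_of_card_ne_zero (by simp [hA, hp.ne_zero])
    obtain ⟨f, hf⟩ := exists_injective_trivial_zmod_hom hk hG A (by simp [hA, pow_succ])
    let W := LinearMap.range f.hom.toLinearMap
    have hW (g : G) : W ≤ W.comap (A.ρ g) := by
      rintro _ ⟨x, rfl⟩
      exact ⟨x, Rep.hom_comm_apply f g x⟩
    have hcardW : Nat.card W = p := by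
      rw [← Nat.card_congr (LinearEquiv.ofInjective f.hom.toLinearMap hf).toEquiv, Nat.card_zmod]
    have hcardQ : Nat.card (A.quotient W hW) = p ^ m := by
      have := W.card_eq_card_quotient_mul_card
      rw [hA, hcardW, pow_succ'] at this
      exact (Nat.eq_of_mul_eq_mul_left hp.pos this).symm
    have : Finite (A.quotient W hW) := Nat.finite_of_card_ne_zero (by simp [hcardQ, hp.ne_zero])
    have : Finite (Rep.trivial k G (ZMod p)) := inferInstanceAs (Finite (ZMod p))
    refine (card_H1_le_mul f (A.mkQ W hW) hf W.mkQ_surjective fun x ↦ ?_).trans ?_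
    · exact Submodule.Quotient.mk_eq_zero W
    · rw [pow_succ']
      exact Nat.mul_le_mul_left _ (ih _ hcardQ)

theorem torsionBy_le_comap (A : Rep k G) (a : k) (g : G) :
    Submodule.torsionBy k A a ≤ (Submodule.torsionBy k A a).comap (A.ρ g) := fun x hx ↦ by
  rw [Submodule.mem_comap, Submodule.mem_torsionBy_iff] at *
  rw [← map_smul, hx, map_zero]

theorem finite_and_card_torsionBy_H1_le_of_divisible [Finite G] {p : ℕ} (A : Rep k G)
    (hA : ∀ x : A, ∃ y : A, p • y = x)
    [Finite (Submodule.torsionBy k A (p : k))] :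
    Finite (AddSubgroup.torsionBy (groupCohomology A 1) (p : ℤ)) ∧
      Nat.card (AddSubgroup.torsionBy (groupCohomology A 1) (p : ℤ)) ≤
        Nat.card (groupCohomology (A.subrepresentation _ (torsionBy_le_comap A (p : k))) 1) := by
  let g : A ⟶ A := Rep.ofHom
    ⟨LinearMap.lsmul k A (p : k), fun g ↦ LinearMap.ext fun x ↦ (map_smul (A.ρ g) (p : k) x).symm⟩
  have hg (x : A) : g.hom x = (p : k) • x := rfl
  have hmap (x : groupCohomology A 1) : map (MonoidHom.id G) g 1 x = (p : k) • x := by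
    induction x using H1_induction_on with | h x =>
    rw [← map_smul, H1π_comp_map_apply]
    congr 1
  have key (x : AddSubgroup.torsionBy (groupCohomology A 1) (p : ℤ)) :
      ∃ y : groupCohomology (A.subrepresentation _ (torsionBy_le_comap A (p : k))) 1,
        map (MonoidHom.id G) (A.subtype _ (torsionBy_le_comap A (p : k))) 1 y = x.1 := by
    refine exists_map_eq_of_map_eq_zero _ g Subtype.val_injective (fun x ↦ ?_) (fun x ↦ ?_) _ ?_
    · obtain ⟨y, hy⟩ := hA x
      exact ⟨y, by rw [hg, ← hy, Nat.cast_smul_eq_nsmul]⟩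
    · rw [hg]
      exact ⟨fun h ↦ ⟨⟨x, h⟩, rfl⟩, by rintro ⟨y, rfl⟩; exact y.2⟩
    · rw [hmap, Nat.cast_smul_eq_nsmul, ← natCast_zsmul]
      exact x.2
  choose s hs using key
  have hinj : Function.Injective s := fun x y hxy ↦
    Subtype.ext <| by rw [← hs x, ← hs y, hxy]
  have : Finite (A.subrepresentation _ (torsionBy_le_comap A (p : k))) :=
    ‹Finite (Submodule.torsionBy k A (p : k))›
  exact ⟨Finite.of_injective s hinj, Nat.card_le_card_of_injective s hinj⟩

theorem finite_H1_of_finite_torsionBy [Finite G] {p : ℕ} [Fact p.Prime] (hG : IsPGroup p G)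
    (A : Rep k G) [Finite (AddSubgroup.torsionBy (groupCohomology A 1) (p : ℤ))] :
    Finite (groupCohomology A 1) := by
  obtain ⟨m, hm⟩ := IsPGroup.iff_card.1 hG
  have := (AddSubgroup.finite_and_card_torsionBy_pow_le (A := groupCohomology A 1) (p : ℤ) m).1
  refine Finite.of_injective (β := AddSubgroup.torsionBy (groupCohomology A 1) ((p : ℤ) ^ m))
    (fun x ↦ ⟨x, ?_⟩) fun x y h ↦ congrArg Subtype.val h
  rw [AddSubgroup.mem_torsionBy_iff, ← Nat.cast_pow, natCast_zsmul, ← hm]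
  exact natCard_smul_H1_eq_zero A x

theorem finite_and_card_torsionBy_pow_H1_le [Finite G] {p : ℕ} [Fact p.Prime]
    [Module k (ZMod p)] (hk : Function.Surjective (Int.cast : ℤ → k)) (hG : IsPGroup p G)
    {A M C : Rep k G} (f : A ⟶ M) (g : M ⟶ C)
    (hf : Function.Injective f.hom) (hg : Function.Surjective g.hom)
    (hfg : Function.Exact f.hom g.hom) (hA : ∀ x : A, ∃ y : A, p • y = x) {r t : ℕ}
    (hr : Nat.card {x : A // p • x = 0} = p ^ r) (ht : Nat.card C = p ^ t) {n : ℕ} (hn : 1 ≤ n) :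
    Finite (AddSubgroup.torsionBy (groupCohomology M 1) ((p : ℤ) ^ n)) ∧
      Nat.card (AddSubgroup.torsionBy (groupCohomology M 1) ((p : ℤ) ^ n)) ≤
        Nat.card (groupCohomology (Rep.trivial k G (ZMod p)) 1) ^ (n * (r + t)) := by
  have hp : p.Prime := Fact.out
  have : Finite (Rep.trivial k G (ZMod p)) := inferInstanceAs (Finite (ZMod p))
  set c := Nat.card (groupCohomology (Rep.trivial k G (ZMod p)) 1)
  have hc : 0 < c := Nat.card_pos
  have : Finite C := Nat.finite_of_card_ne_zero (by simp [ht, hp.ne_zero])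
  have hAp : Nat.card (A.subrepresentation _ (torsionBy_le_comap A (p : k))) = p ^ r := by
    rw [← hr]
    refine Nat.card_congr (Equiv.subtypeEquivRight fun x ↦ ?_)
    rw [Submodule.mem_torsionBy_iff, Nat.cast_smul_eq_nsmul]
  have hfin : Finite (A.subrepresentation _ (torsionBy_le_comap A (p : k))) :=
    Nat.finite_of_card_ne_zero (hAp ▸ pow_ne_zero r hp.ne_zero)
  have : Finite (Submodule.torsionBy k A (p : k)) := hfin
  obtain ⟨_, hA₂⟩ := finite_and_card_torsionBy_H1_le_of_divisible A hA
  replace hA₂ := hA₂.trans (card_H1_le_of_card_eq_pow hk hG r _ hAp)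
  have : Finite (groupCohomology A 1) := finite_H1_of_finite_torsionBy hG A
  let φ := (map (MonoidHom.id G) f 1).hom.toAddMonoidHom
  let ψ := (map (MonoidHom.id G) g 1).hom.toAddMonoidHom
  have hφ : Finite φ.range := Finite.of_surjective _ φ.rangeRestrict_surjective
  let i : AddSubgroup.torsionBy φ.range ((p : ℤ) ^ n) →+
      AddSubgroup.torsionBy (groupCohomology M 1) ((p : ℤ) ^ n) :=
    (φ.range.subtype.comp (AddSubgroup.subtype _)).codRestrict _
      fun x ↦ congrArg Subtype.val x.2
  obtain ⟨hM₁, hM₂⟩ := AddMonoidHom.finite_and_card_le_of_ker_le_range i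
    (ψ.comp (AddSubgroup.subtype _)) fun x hx ↦
      ⟨⟨⟨x, exists_map_eq_of_map_eq_zero f g hf hg hfg x hx⟩, Subtype.ext x.2⟩, rfl⟩
  refine ⟨hM₁, hM₂.trans ?_⟩
  calc
    _ ≤ c ^ (r * n) * c ^ t := by
      refine Nat.mul_le_mul ?_ (card_H1_le_of_card_eq_pow hk hG t C ht)
      rw [pow_mul]
      exact (AddSubgroup.card_torsionBy_le_of_surjective φ.rangeRestrict
        φ.rangeRestrict_surjective _).trans <|
        (AddSubgroup.finite_and_card_torsionBy_pow_le (p : ℤ) n).2.trans <|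
        Nat.pow_le_pow_left hA₂ n
    _ ≤ c ^ (n * (r + t)) := by
      rw [← pow_add]
      exact Nat.pow_le_pow_right hc (by nlinarith)

theorem finite_and_card_torsionBy_pow_H1_le_of_addSubgroup [Finite G] {p : ℕ} [Fact p.Prime]
    [Module k (ZMod p)] (hk : Function.Surjective (Int.cast : ℤ → k)) (hG : IsPGroup p G)
    (M : Rep k G) (D : AddSubgroup M) (hDinv : ∀ g, ∀ x ∈ D, M.ρ g x ∈ D)
    (hDdiv : ∀ x ∈ D, ∃ y ∈ D, p • y = x) {r t : ℕ}
    (hDp : Nat.card {x : M // x ∈ D ∧ p • x = 0} = p ^ r) (hMD : Nat.card (M ⧸ D) = p ^ t)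
    {n : ℕ} (hn : 1 ≤ n) :
    Finite (AddSubgroup.torsionBy (groupCohomology M 1) ((p : ℤ) ^ n)) ∧
      Nat.card (AddSubgroup.torsionBy (groupCohomology M 1) ((p : ℤ) ^ n)) ≤
        Nat.card (groupCohomology (Rep.trivial k G (ZMod p)) 1) ^ (n * (r + t)) := by
  let W : Submodule k M :=
    { D with
      smul_mem' := fun a x hx ↦ by
        obtain ⟨m, rfl⟩ := hk a
        rw [Int.cast_smul_eq_zsmul]
        exact D.zsmul_mem hx m }
  have hW (g : G) : W ≤ W.comap (M.ρ g) := fun x hx ↦ hDinv g x hx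
  refine finite_and_card_torsionBy_pow_H1_le hk hG (M.subtype W hW) (M.mkQ W hW)
    Subtype.val_injective W.mkQ_surjective (fun x ↦ ?_) (fun x ↦ ?_) ?_ hMD hn
  · exact (Submodule.Quotient.mk_eq_zero W).trans
      ⟨fun h ↦ ⟨⟨x, h⟩, rfl⟩, by rintro ⟨y, rfl⟩; exact y.2⟩
  · obtain ⟨y, hy, hyx⟩ := hDdiv x x.2
    exact ⟨⟨y, hy⟩, Subtype.ext hyx⟩
  · rw [← hDp]
    exact Nat.card_congr
      { toFun := fun x ↦ ⟨x.1.1, x.1.2, congrArg Subtype.val x.2⟩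
        invFun := fun x ↦ ⟨⟨x.1, x.2.1⟩, Subtype.ext x.2.2⟩
        left_inv := fun _ ↦ rfl
        right_inv := fun _ ↦ rfl }

theorem smul_H1_trivial_zmod_eq_zero {p : ℕ} [Module k (ZMod p)]
    (x : groupCohomology (Rep.trivial k G (ZMod p)) 1) :
    p • x = 0 := by
  induction x using H1_induction_on with | h x =>
  rw [← map_nsmul]
  convert map_zero (H1π (Rep.trivial k G (ZMod p))).hom
  ext g
  exact (nsmul_eq_mul p (α := ZMod p) (x g)).trans (by rw [CharP.cast_eq_zero, zero_mul]; rfl)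

end groupCohomology

theorem card_eq_pow_rp {p : ℕ} [Fact p.Prime] {N : Type*} [AddCommGroup N] [Finite N]
    (hN : ∀ x : N, p • x = 0) : Nat.card N = p ^ rp p N := by
  let _ := AddSubgroup.torsionBy.zmodModule (A := N) (n := p)
  have htop : AddSubgroup.torsionBy N p = ⊤ := by
    ext x
    simpa [AddSubgroup.mem_torsionBy_iff] using hN x
  calc
    Nat.card N = Nat.card (AddSubgroup.torsionBy N p) := by rw [htop, AddSubgroup.card_top]
    _ = p ^ rp p N := by
      rw [Module.natCard_eq_pow_finrank (K := ZMod p), Nat.card_zmod]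
      rfl

theorem order_bound_on_pow_torsion_of_H1
    (p : ℕ) (hp : p.Prime) (G : Type) [Group G] [Finite G] (hG : IsPGroup p G)
    (M : Rep ℤ G) (hMtors : ∀ x : M, ∃ k : ℕ, p ^ k • x = 0)
    (D : Submodule ℤ M.V)
    (hDinv : ∀ (g : G), ∀ x ∈ D, M.ρ g x ∈ D)
    (hDdiv : ∀ x ∈ D, ∃ y ∈ D, p • y = x)
    (r t : ℕ)
    (hDp : Nat.card {x : M // x ∈ D ∧ p • x = 0} = p ^ r)
    (hMD : Nat.card (M.V ⧸ D) = p ^ t)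
    (n : ℕ) (hn : 1 ≤ n) :
    Finite (AddSubgroup.torsionBy (groupCohomology M 1) ((p : ℤ) ^ n)) ∧
      Nat.card (AddSubgroup.torsionBy (groupCohomology M 1) ((p : ℤ) ^ n)) ≤
        p ^ (n * rp p (groupCohomology (Rep.trivial ℤ G (ZMod p)) 1) * (r + t)) := by
  have := Fact.mk hp
  have : Finite (Rep.trivial ℤ G (ZMod p)) := inferInstanceAs (Finite (ZMod p))
  have key := finite_and_card_torsionBy_pow_H1_le_of_addSubgroup (fun m ↦ ⟨m, Int.cast_id⟩) hG M
    D.toAddSubgroup hDinv hDdiv hDp hMD hn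
  rwa [card_eq_pow_rp (p := p) smul_H1_trivial_zmod_eq_zero, ← pow_mul, ← mul_assoc,
    mul_comm _ n] at key
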